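/- Fix p ∈ ℝ. For each integer n ≥ 1, the function x ↦ Real.log x is integrable with respect to GIG(p; n, n), and n · ∫ Real.log x d(GIG(p; n, n))(x) converges to p as n → ∞; that is, Tendsto (fun n : ℕ => (n : ℝ) * ∫ x, Real.log x ∂(GIG(p; n, n))) atTop (nhds p). -/

import Mathlib

open MeasureTheory Filter

/-- Unnormalized density of the generalized inverse Gaussian distribution `GIG(p; a, b)`. -/
noncomputable def gigDensity (p a b : ℝ) (x : ℝ) : ENNReal :=
  if 0 < x then ENNReal.ofReal (x ^ (p - 1) * Real.exp (-(a * x + b / x) / 2)) else 0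

/-- The (scalar) generalized inverse Gaussian distribution `GIG(p; a, b)`. -/
noncomputable def GIG (p a b : ℝ) : Measure ℝ :=
  ((volume.withDensity (gigDensity p a b)) Set.univ)⁻¹ • volume.withDensity (gigDensity p a b)

open scoped Topology

/-- The density of `GIG(p; r ^ 2, r ^ 2)` in the coordinate `s = r * log x`, up to a constant. -/
noncomputable def gigKernel (p r s : ℝ) : ℝ :=
  Real.exp (p * (s / r)) * Real.exp (-(r ^ 2 * (Real.cosh (s / r) - 1)))

theorem gigKernel_pos (p r s : ℝ) : 0 < gigKernel p r s := by
  unfold gigKernel; positivity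

theorem continuous_gigKernel (p r : ℝ) : Continuous (gigKernel p r) := by
  unfold gigKernel
  have := Real.continuous_cosh
  fun_prop

theorem Real.cosh_sub_one_eq_two_mul_sinh_half_sq (u : ℝ) :
    Real.cosh u - 1 = 2 * Real.sinh (u / 2) ^ 2 := by
  have h := Real.cosh_two_mul (u / 2)
  rw [mul_div_cancel₀ u two_ne_zero, Real.cosh_sq] at h
  linarith

theorem Real.half_sq_le_cosh_sub_one (u : ℝ) : u ^ 2 / 2 ≤ Real.cosh u - 1 := by
  rw [Real.cosh_sub_one_eq_two_mul_sinh_half_sq]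
  have h : (u / 2) ^ 2 ≤ Real.sinh (u / 2) ^ 2 := by
    rw [sq_le_sq, Real.abs_sinh]
    exact Real.self_le_sinh_iff.2 (abs_nonneg _)
  nlinarith

theorem Real.abs_exp_sub_one_le_abs_mul_exp_abs (y : ℝ) :
    |Real.exp y - 1| ≤ |y| * Real.exp |y| := by
  rw [abs_le]
  have h1 := Real.add_one_le_exp y
  have h2 := Real.add_one_le_exp (-y)
  have h3 : Real.exp y * Real.exp (-y) = 1 := by rw [← Real.exp_add]; simp
  have h4 := Real.exp_pos y
  have h5 : (1 : ℝ) ≤ Real.exp |y| := Real.one_le_exp (abs_nonneg y)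
  constructor
  · nlinarith [neg_abs_le y, abs_nonneg y]
  · calc Real.exp y - 1 ≤ y * Real.exp y := by nlinarith
      _ ≤ |y| * Real.exp |y| := by
        gcongr <;> exact le_abs_self y

theorem exp_neg_cosh_le {r : ℝ} (hr : 0 < r) (s : ℝ) :
    Real.exp (-(r ^ 2 * (Real.cosh (s / r) - 1))) ≤ Real.exp (-(s ^ 2 / 2)) := by
  have h := mul_le_mul_of_nonneg_left (Real.half_sq_le_cosh_sub_one (s / r)) (sq_nonneg r)
  have h2 : r ^ 2 * ((s / r) ^ 2 / 2) = s ^ 2 / 2 := by field_simp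
  exact Real.exp_le_exp.2 (by linarith)

theorem abs_mul_div_le {r : ℝ} (hr : 1 ≤ r) (p s : ℝ) : |p * (s / r)| ≤ |p| * |s| := by
  rw [abs_mul, abs_div, abs_of_pos (by linarith : 0 < r)]
  gcongr
  exact div_le_self (abs_nonneg s) hr

theorem gaussian_bound (p s : ℝ) :
    (1 + s ^ 2) * (Real.exp (|p| * |s|) * Real.exp (-(s ^ 2 / 2))) ≤
      8 * Real.exp (p ^ 2) * Real.exp (-(1 / 8) * s ^ 2) := by
  have h1 : 1 + s ^ 2 ≤ 8 * Real.exp (s ^ 2 / 8) := by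
    nlinarith [Real.add_one_le_exp (s ^ 2 / 8), sq_nonneg s]
  have h2 : Real.exp (|p| * |s|) * Real.exp (-(s ^ 2 / 2)) ≤
      Real.exp (p ^ 2) * Real.exp (-(s ^ 2 / 4)) := by
    rw [← Real.exp_add, ← Real.exp_add]
    apply Real.exp_le_exp.2
    nlinarith [sq_nonneg (|p| - |s| / 2), sq_abs p, sq_abs s]
  calc _ ≤ 8 * Real.exp (s ^ 2 / 8) * (Real.exp (p ^ 2) * Real.exp (-(s ^ 2 / 4))) := by
        gcongr
    _ = 8 * Real.exp (p ^ 2) * (Real.exp (s ^ 2 / 8) * Real.exp (-(s ^ 2 / 4))) := by ring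
    _ = _ := by rw [← Real.exp_add]; ring_nf

theorem integrable_gaussian_bound (C : ℝ) :
    Integrable fun s : ℝ => C * Real.exp (-(1 / 8) * s ^ 2) :=
  (integrable_exp_neg_mul_sq (by norm_num)).const_mul C

theorem gigKernel_le {r : ℝ} (hr : 1 ≤ r) (p s : ℝ) :
    gigKernel p r s ≤ Real.exp (|p| * |s|) * Real.exp (-(s ^ 2 / 2)) := by
  unfold gigKernel
  gcongr ?_ * ?_
  · exact Real.exp_le_exp.2 ((le_abs_self _).trans (abs_mul_div_le hr p s))
  · exact exp_neg_cosh_le (by linarith) s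

theorem integrable_mul_gigKernel {r : ℝ} (hr : 1 ≤ r) (p : ℝ) {f : ℝ → ℝ} (hf : Continuous f)
    {C : ℝ} (hC : 0 ≤ C) (hfC : ∀ s, |f s| ≤ C * (1 + s ^ 2)) :
    Integrable fun s => f s * gigKernel p r s := by
  refine (integrable_gaussian_bound (C * (8 * Real.exp (p ^ 2)))).mono'
    (hf.mul (continuous_gigKernel p r)).aestronglyMeasurable (ae_of_all _ fun s => ?_)
  rw [Real.norm_eq_abs, abs_mul, abs_of_pos (gigKernel_pos p r s)]
  calc |f s| * gigKernel p r s
      ≤ C * (1 + s ^ 2) * (Real.exp (|p| * |s|) * Real.exp (-(s ^ 2 / 2))) := by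
        gcongr ?_ * ?_
        · exact (gigKernel_pos p r s).le
        · exact hfC s
        · exact gigKernel_le hr p s
    _ ≤ C * (8 * Real.exp (p ^ 2) * Real.exp (-(1 / 8) * s ^ 2)) := by
        rw [mul_assoc]; exact mul_le_mul_of_nonneg_left (gaussian_bound p s) hC
    _ = _ := by ring

theorem integrable_gigKernel {r : ℝ} (hr : 1 ≤ r) (p : ℝ) : Integrable (gigKernel p r) := by
  simpa using integrable_mul_gigKernel hr p (f := fun _ => 1) continuous_const zero_le_one
    (fun s => by simp [sq_nonneg])

theorem abs_le_one_add_sq (s : ℝ) : |s| ≤ 1 + s ^ 2 := by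
  nlinarith [sq_abs s, sq_nonneg (|s| - 1)]

theorem integrable_id_mul_gigKernel {r : ℝ} (hr : 1 ≤ r) (p : ℝ) :
    Integrable fun s => s * gigKernel p r s :=
  integrable_mul_gigKernel hr p continuous_id zero_le_one
    (fun s => by simpa using abs_le_one_add_sq s)

theorem HasDerivAt.tendsto_mul_comp_div {f : ℝ → ℝ} {f' : ℝ} (hf : HasDerivAt f f' 0)
    (h0 : f 0 = 0) (s : ℝ) : Tendsto (fun r : ℝ => r * f (s / r)) atTop (𝓝 (f' * s)) := by
  have h1 : HasDerivAt (fun u : ℝ => f (s * u)) (f' * s) 0 := by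
    have h2 : HasDerivAt (fun u : ℝ => s * u) s 0 := by
      simpa using (hasDerivAt_id (0 : ℝ)).const_mul s
    exact HasDerivAt.comp (0 : ℝ) (by simpa using hf) h2
  have h3 := h1.tendsto_slope_zero_right.comp tendsto_inv_atTop_nhdsGT_zero
  simpa [Function.comp_def, h0, div_eq_mul_inv] using h3

theorem tendsto_exp_neg_cosh (s : ℝ) :
    Tendsto (fun r : ℝ => Real.exp (-(r ^ 2 * (Real.cosh (s / r) - 1)))) atTop
      (𝓝 (Real.exp (-(s ^ 2 / 2)))) := by
  refine (Real.continuous_exp.tendsto _).comp (Tendsto.neg ?_)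
  have h := (Real.hasDerivAt_sinh 0).tendsto_mul_comp_div Real.sinh_zero (s / 2)
  have h2 := (h.pow 2).const_mul 2
  convert h2 using 2 with r
  · rw [Real.cosh_sub_one_eq_two_mul_sinh_half_sq, div_right_comm]; ring
  · simp; ring

theorem tendsto_div_atTop_zero (s : ℝ) : Tendsto (fun r : ℝ => s / r) atTop (𝓝 0) :=
  tendsto_const_nhds.div_atTop tendsto_id

theorem tendsto_integral_gigKernel (p : ℝ) :
    Tendsto (fun r : ℝ => ∫ s, gigKernel p r s) atTop (𝓝 (∫ s, Real.exp (-(s ^ 2 / 2)))) := by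
  refine tendsto_integral_filter_of_dominated_convergence
    (fun s => 8 * Real.exp (p ^ 2) * Real.exp (-(1 / 8) * s ^ 2))
    (Eventually.of_forall fun r => (continuous_gigKernel p r).aestronglyMeasurable) ?_
    (integrable_gaussian_bound _) (ae_of_all _ fun s => ?_)
  · filter_upwards [eventually_ge_atTop 1] with r hr
    refine ae_of_all _ fun s => ?_
    rw [Real.norm_eq_abs, abs_of_pos (gigKernel_pos p r s)]
    refine (gigKernel_le hr p s).trans (le_trans ?_ (gaussian_bound p s))
    exact le_mul_of_one_le_left (by positivity) (by nlinarith [sq_nonneg s])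
  · have h := (Real.continuous_exp.tendsto _).comp ((tendsto_div_atTop_zero s).const_mul p)
    simpa [gigKernel] using h.mul (tendsto_exp_neg_cosh s)

theorem integral_id_mul_gigKernel_zero (r : ℝ) : ∫ s, s * gigKernel 0 r s = 0 := by
  have h := integral_neg_eq_self (fun s => s * gigKernel 0 r s) volume
  have h2 : (fun s => -s * gigKernel 0 r (-s)) = fun s => -(s * gigKernel 0 r s) := by
    ext s; simp [gigKernel, neg_div]
  simp only [h2, integral_neg] at h
  linarith

theorem integral_mul_gigKernel {r : ℝ} (hr : 1 ≤ r) (p : ℝ) :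
    ∫ s, r * s * gigKernel p r s =
      ∫ s, r * s * (Real.exp (p * (s / r)) - 1) *
        Real.exp (-(r ^ 2 * (Real.cosh (s / r) - 1))) := by
  have h : ∀ s, r * s * (Real.exp (p * (s / r)) - 1) *
        Real.exp (-(r ^ 2 * (Real.cosh (s / r) - 1))) =
      r * (s * gigKernel p r s) - r * (s * gigKernel 0 r s) := by
    intro s; simp [gigKernel]; ring
  simp_rw [h, mul_assoc]
  rw [integral_sub ((integrable_id_mul_gigKernel hr p).const_mul r)
    ((integrable_id_mul_gigKernel hr 0).const_mul r),
    integral_const_mul r (fun s => s * gigKernel 0 r s), integral_id_mul_gigKernel_zero]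
  simp

theorem integral_sq_mul_exp_neg_half_sq :
    ∫ s : ℝ, s ^ 2 * Real.exp (-(s ^ 2 / 2)) = ∫ s : ℝ, Real.exp (-(s ^ 2 / 2)) := by
  have hI : ∀ f : ℝ → ℝ, Continuous f → (∀ s, |f s| ≤ 1 + s ^ 2) →
      Integrable fun s => f s * Real.exp (-(s ^ 2 / 2)) := by
    intro f hf hb
    refine (integrable_gaussian_bound (8 * Real.exp (0 ^ 2))).mono'
      (by fun_prop) (ae_of_all _ fun s => ?_)
    rw [Real.norm_eq_abs, abs_mul, abs_of_pos (Real.exp_pos _)]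
    refine le_trans ?_ (gaussian_bound 0 s)
    simpa using mul_le_mul_of_nonneg_right (hb s) (Real.exp_pos _).le
  have h := integral_mul_deriv_eq_deriv_mul_of_integrable (u := fun s : ℝ => s)
    (v := fun s => -Real.exp (-(s ^ 2 / 2))) (u' := fun _ => 1)
    (v' := fun s => s * Real.exp (-(s ^ 2 / 2))) (fun s _ => hasDerivAt_id s)
    (fun s _ => by
      have h := ((((hasDerivAt_id' s).fun_pow 2).div_const 2).fun_neg.exp).fun_neg
      refine h.congr_deriv ?_
      push_cast
      ring)
    (by
      refine (hI (fun s => s ^ 2) (by fun_prop) fun s => ?_).congr (ae_of_all _ fun s => ?_)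
      · rw [abs_of_nonneg (sq_nonneg s)]; linarith
      · simp; ring)
    (by
      refine (hI (fun s => -1) (by fun_prop) fun s => ?_).congr (ae_of_all _ fun s => ?_)
      · simp [sq_nonneg]
      · simp)
    (by
      refine (hI (fun s => -s) (by fun_prop) fun s => ?_).congr (ae_of_all _ fun s => ?_)
      · simpa using abs_le_one_add_sq s
      · simp)
  simp only [one_mul, integral_neg, neg_neg] at h
  rw [← h]
  congr 1 with s
  ring

theorem tendsto_integral_mul_gigKernel (p : ℝ) :
    Tendsto (fun r : ℝ => ∫ s, r * s * gigKernel p r s) atTop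
      (𝓝 (p * ∫ s, Real.exp (-(s ^ 2 / 2)))) := by
  rw [← integral_sq_mul_exp_neg_half_sq, ← integral_const_mul]
  suffices h : Tendsto (fun r : ℝ => ∫ s, r * s * (Real.exp (p * (s / r)) - 1) *
        Real.exp (-(r ^ 2 * (Real.cosh (s / r) - 1)))) atTop
      (𝓝 (∫ s, p * (s ^ 2 * Real.exp (-(s ^ 2 / 2))))) by
    refine h.congr' ?_
    filter_upwards [eventually_ge_atTop 1] with r hr
    exact (integral_mul_gigKernel hr p).symm
  have hc := Real.continuous_cosh
  refine tendsto_integral_filter_of_dominated_convergence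
    (fun s => |p| * (8 * Real.exp (p ^ 2)) * Real.exp (-(1 / 8) * s ^ 2))
    (Eventually.of_forall fun r => by fun_prop) ?_
    (integrable_gaussian_bound _) (ae_of_all _ fun s => ?_)
  · filter_upwards [eventually_ge_atTop 1] with r hr
    refine ae_of_all _ fun s => ?_
    have hr0 : 0 < r := by linarith
    rw [Real.norm_eq_abs, abs_mul, abs_mul, abs_mul, Real.abs_exp, abs_of_pos hr0]
    calc r * |s| * |Real.exp (p * (s / r)) - 1| * Real.exp (-(r ^ 2 * (Real.cosh (s / r) - 1)))
        ≤ r * |s| * (|p * (s / r)| * Real.exp (|p| * |s|)) * Real.exp (-(s ^ 2 / 2)) := by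
          gcongr ?_ * ?_ * ?_
          · refine (Real.abs_exp_sub_one_le_abs_mul_exp_abs _).trans ?_
            gcongr
            exact abs_mul_div_le hr p s
          · exact exp_neg_cosh_le hr0 s
      _ = |p| * (s ^ 2 * (Real.exp (|p| * |s|) * Real.exp (-(s ^ 2 / 2)))) := by
          rw [abs_mul, abs_div, abs_of_pos hr0, ← sq_abs s]
          field_simp
      _ ≤ |p| * ((1 + s ^ 2) * (Real.exp (|p| * |s|) * Real.exp (-(s ^ 2 / 2)))) := by
          gcongr; linarith
      _ ≤ _ := by
          rw [mul_assoc |p|]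
          exact mul_le_mul_of_nonneg_left (gaussian_bound p s) (abs_nonneg p)
  · have hd : HasDerivAt (fun u : ℝ => Real.exp (p * u) - 1) p 0 := by
      simpa using ((((hasDerivAt_id (0 : ℝ)).const_mul p).exp).sub_const 1)
    have h := ((hd.tendsto_mul_comp_div (by simp) s).const_mul s).mul (tendsto_exp_neg_cosh s)
    convert h using 2
    · ring
    · ring

theorem measurable_gigDensity (p a b : ℝ) : Measurable (gigDensity p a b) := by
  unfold gigDensity
  exact Measurable.ite measurableSet_Ioi (by fun_prop) measurable_const

theorem gigDensity_lt_top (p a b x : ℝ) : gigDensity p a b x < ⊤ := by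
  unfold gigDensity
  split_ifs <;> simp

theorem toReal_gigDensity_mul (p a b : ℝ) (h : ℝ → ℝ) :
    (fun x => (gigDensity p a b x).toReal • h x) =
      (Set.Ioi 0).indicator fun x => x ^ (p - 1) * Real.exp (-(a * x + b / x) / 2) * h x := by
  ext x
  by_cases hx : 0 < x
  · have : 0 ≤ x ^ (p - 1) * Real.exp (-(a * x + b / x) / 2) := by positivity
    simp only [gigDensity, if_pos hx, ENNReal.toReal_ofReal this, smul_eq_mul,
      Set.indicator_of_mem (Set.mem_Ioi.2 hx)]
  · simp [gigDensity, hx]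

theorem exp_div_mul_gigDensity {r : ℝ} (hr : 0 < r) (p : ℝ) (h : ℝ → ℝ) (s : ℝ) :
    |Real.exp (s / r) * (1 / r)| • (Real.exp (s / r) ^ (p - 1) *
      Real.exp (-(r ^ 2 * Real.exp (s / r) + r ^ 2 / Real.exp (s / r)) / 2) *
        h (Real.exp (s / r))) =
      Real.exp (-r ^ 2) / r * (h (Real.exp (s / r)) * gigKernel p r s) := by
  rw [abs_of_pos (by positivity), ← Real.exp_mul, gigKernel, Real.cosh_eq, div_eq_mul_inv (r ^ 2),
    ← Real.exp_neg, smul_eq_mul]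
  have e : Real.exp (s / r) * (Real.exp (s / r * (p - 1)) *
      Real.exp (-(r ^ 2 * Real.exp (s / r) + r ^ 2 * Real.exp (-(s / r))) / 2)) =
      Real.exp (-r ^ 2) * (Real.exp (p * (s / r)) *
        Real.exp (-(r ^ 2 * ((Real.exp (s / r) + Real.exp (-(s / r))) / 2 - 1)))) := by
    simp only [← Real.exp_add]
    congr 1
    ring
  linear_combination (1 / r) * h (Real.exp (s / r)) * e

theorem image_exp_div {r : ℝ} (hr : 0 < r) :
    (fun s : ℝ => Real.exp (s / r)) '' Set.univ = Set.Ioi 0 := by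
  ext x
  simp only [Set.image_univ, Set.mem_range, Set.mem_Ioi]
  constructor
  · rintro ⟨s, rfl⟩; positivity
  · intro hx
    exact ⟨r * Real.log x, by rw [mul_div_cancel_left₀ _ hr.ne', Real.exp_log hx]⟩

theorem hasDerivAt_exp_div (r s : ℝ) :
    HasDerivAt (fun s : ℝ => Real.exp (s / r)) (Real.exp (s / r) * (1 / r)) s :=
  ((hasDerivAt_id s).div_const r).exp

theorem injective_exp_div {r : ℝ} (hr : 0 < r) :
    Function.Injective fun s : ℝ => Real.exp (s / r) :=
  Real.exp_injective.comp fun _ _ h => (div_left_inj' hr.ne').1 h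

theorem integral_withDensity_gigDensity {r : ℝ} (hr : 0 < r) (p : ℝ) (h : ℝ → ℝ) :
    ∫ x, h x ∂(volume.withDensity (gigDensity p (r ^ 2) (r ^ 2))) =
      Real.exp (-r ^ 2) / r * ∫ s, h (Real.exp (s / r)) * gigKernel p r s := by
  rw [integral_withDensity_eq_integral_toReal_smul (measurable_gigDensity _ _ _)
    (ae_of_all _ fun x => gigDensity_lt_top _ _ _ x), toReal_gigDensity_mul,
    integral_indicator measurableSet_Ioi, ← image_exp_div hr,
    integral_image_eq_integral_abs_deriv_smul MeasurableSet.univ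
      (fun s _ => (hasDerivAt_exp_div r s).hasDerivWithinAt) (injective_exp_div hr).injOn]
  simp_rw [exp_div_mul_gigDensity hr, setIntegral_univ, integral_const_mul]

theorem integrable_withDensity_gigDensity {r : ℝ} (hr : 0 < r) (p : ℝ) {h : ℝ → ℝ}
    (hh : Integrable fun s => h (Real.exp (s / r)) * gigKernel p r s) :
    Integrable h (volume.withDensity (gigDensity p (r ^ 2) (r ^ 2))) := by
  rw [integrable_withDensity_iff_integrable_smul' (measurable_gigDensity _ _ _)
    (ae_of_all _ fun x => gigDensity_lt_top _ _ _ x), toReal_gigDensity_mul,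
    integrable_indicator_iff measurableSet_Ioi, ← image_exp_div hr,
    integrableOn_image_iff_integrableOn_abs_deriv_smul MeasurableSet.univ
      (fun s _ => (hasDerivAt_exp_div r s).hasDerivWithinAt) (injective_exp_div hr).injOn]
  simp_rw [exp_div_mul_gigDensity hr, integrableOn_univ]
  exact hh.const_mul _

theorem integral_gigKernel_pos {r : ℝ} (hr : 1 ≤ r) (p : ℝ) : 0 < ∫ s, gigKernel p r s :=
  integral_pos_of_integrable_nonneg_nonzero (continuous_gigKernel p r) (integrable_gigKernel hr p)
    (fun s => (gigKernel_pos p r s).le) (gigKernel_pos p r 0).ne'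

theorem toReal_withDensity_gigDensity_univ {r : ℝ} (hr : 0 < r) (p : ℝ) :
    (volume.withDensity (gigDensity p (r ^ 2) (r ^ 2)) Set.univ).toReal =
      Real.exp (-r ^ 2) / r * ∫ s, gigKernel p r s := by
  simpa [Measure.real] using integral_withDensity_gigDensity hr p (fun _ => 1)

theorem integrable_log_GIG {r : ℝ} (hr : 1 ≤ r) (p : ℝ) :
    Integrable Real.log (GIG p (r ^ 2) (r ^ 2)) := by
  have hr0 : 0 < r := by linarith
  refine (integrable_withDensity_gigDensity hr0 p ?_).smul_measure ?_
  · simpa [div_mul_eq_mul_div] using (integrable_id_mul_gigKernel hr p).div_const r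
  · rw [ne_eq, ENNReal.inv_eq_top]
    intro h
    have h2 := toReal_withDensity_gigDensity_univ hr0 p
    have := integral_gigKernel_pos hr p
    rw [h, ENNReal.toReal_zero] at h2
    have : 0 < Real.exp (-r ^ 2) / r * ∫ s, gigKernel p r s := by positivity
    linarith

theorem sq_mul_integral_log_GIG {r : ℝ} (hr : 1 ≤ r) (p : ℝ) :
    r ^ 2 * ∫ x, Real.log x ∂(GIG p (r ^ 2) (r ^ 2)) =
      (∫ s, r * s * gigKernel p r s) / ∫ s, gigKernel p r s := by
  have hr0 : 0 < r := by linarith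
  have hpos := integral_gigKernel_pos hr p
  rw [GIG, integral_smul_measure, ENNReal.toReal_inv, toReal_withDensity_gigDensity_univ hr0,
    integral_withDensity_gigDensity hr0]
  simp_rw [Real.log_exp, div_mul_eq_mul_div, mul_assoc, integral_div, integral_const_mul,
    smul_eq_mul]
  field_simp

/-- `log` is integrable under `GIG(p; n, n)` for every `n ≥ 1`, and
`n · ∫ log x d(GIG(p; n, n))(x) → p` as `n → ∞`. -/
theorem stmt_16 (p : ℝ) :
    (∀ n : ℕ, 1 ≤ n → Integrable Real.log (GIG p n n)) ∧
      Tendsto (fun n : ℕ => (n : ℝ) * ∫ x, Real.log x ∂(GIG p n n)) atTop (nhds p) := by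
  have hsq : ∀ n : ℕ, √(n : ℝ) ^ 2 = n := fun n => Real.sq_sqrt n.cast_nonneg
  have hone : ∀ n : ℕ, 1 ≤ n → 1 ≤ √(n : ℝ) := fun n hn =>
    Real.one_le_sqrt.2 (by exact_mod_cast hn)
  refine ⟨fun n hn => ?_, ?_⟩
  · simpa only [hsq] using integrable_log_GIG (hone n hn) p
  · have hI : (∫ s : ℝ, Real.exp (-(s ^ 2 / 2))) ≠ 0 := by
      have h := integral_gaussian (1 / 2)
      have h2 : ∀ s : ℝ, -(s ^ 2 / 2) = -(1 / 2) * s ^ 2 := fun s => by ring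
      simp_rw [h2, h]
      positivity
    have h := (tendsto_integral_mul_gigKernel p).div (tendsto_integral_gigKernel p) hI
    rw [mul_div_cancel_right₀ _ hI] at h
    refine (h.comp (Real.tendsto_sqrt_atTop.comp tendsto_natCast_atTop_atTop)).congr' ?_
    filter_upwards [eventually_ge_atTop 1] with n hn
    have h := sq_mul_integral_log_GIG (hone n hn) p
    rw [hsq] at h
    exact h.symm
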